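/- arXiv:2309.05008 — 3 statements merged into one kernel-verified Lean document; each statement's English description precedes it below -/
import Mathlib

section
/- Let F be a C-Lorentzian symmetric n-multilinear form (n ≥ 3) on a finite-dimensional real vector space V, where C ⊆ V is a nonempty open convex cone with closure C̄. Let Eff ⊆ V be a closed convex cone with C̄ ⊆ Eff such that F(T, α₁, ..., α_{n−1}) ≥ 0 for every T ∈ Eff and all α₁, ..., α_{n−1} ∈ C̄. Let L₁, ..., L_{n−2} ∈ C̄ be a critical collection, i.e. nd(L_I) ≥ |I| + 1 for every nonempty I ⊆ [n−2], and set ker 𝔏 = {η ∈ V : F(L₁,...,L_{n−2}, η, v) = 0 for all v ∈ V}. Let 𝒞 ⊆ Eff be a subset such that: (i) the closed convex cone generated by 𝒞 equals Eff; (ii) the set 𝒞 ∩ ker 𝔏 is finite; (iii) for every D ∈ 𝒞 and all α₁, ..., α_{n−3} ∈ C̄, the symmetric bilinear form (x,y) ↦ F(x, y, D, α₁, ..., α_{n−3}) has at most one positive eigenvalue. Fix r ∈ [n−2]. Then for every α ∈ ker 𝔏 there exists β ∈ V such that: (1) β − α lies in the linear span of 𝒞 ∩ ker 𝔏, and (2)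 F(β, β, T, (L_k)_{k∈[n−2]∖{r}}) ≤ 0 for every T ∈ Eff. -/
/-- `biEval F v x y` is `F` evaluated with first argument `x`, second argument `y`, and the
remaining arguments `v 2, ..., v (n-1)`. -/
noncomputable def biEval {V : Type*} [AddCommGroup V] [Module ℝ V] {n : ℕ}
    (F : MultilinearMap ℝ (fun _ : Fin n => V) ℝ) (v : Fin n → V) (x y : V) : ℝ :=
  F (fun i => if (i : ℕ) = 0 then x else if (i : ℕ) = 1 then y else v i)

/-- `triEval F v D x y` is `F(x, y, D, v 3, ..., v (n-1))`. -/
noncomputable def triEval {V : Type*} [AddCommGroup V] [Module ℝ V] {n : ℕ}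
    (F : MultilinearMap ℝ (fun _ : Fin n => V) ℝ) (v : Fin n → V) (D x y : V) : ℝ :=
  F (fun i => if (i : ℕ) = 0 then x else if (i : ℕ) = 1 then y
    else if (i : ℕ) = 2 then D else v i)

/-- `numDim F w v = max {k ∈ {0,...,n} : F(v[k], w[n-k]) > 0}`, the numerical dimension of `v`
computed with respect to `w` (independent of the choice of `w ∈ C`). -/
noncomputable def numDim {V : Type*} [AddCommGroup V] [Module ℝ V] {n : ℕ}
    (F : MultilinearMap ℝ (fun _ : Fin n => V) ℝ) (w v : V) : ℕ :=
  sSup {k : ℕ | k ≤ n ∧ 0 < F (fun i => if (i : ℕ) < k then v else w)}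

/-- `evalKer F L x y` is `F(L 1, ..., L (n-2), x, y)`. -/
noncomputable def evalKer {V : Type*} [AddCommGroup V] [Module ℝ V] {n : ℕ}
    (F : MultilinearMap ℝ (fun _ : Fin n => V) ℝ) (L : Fin (n - 2) → V) (x y : V) : ℝ :=
  F (fun i => if h : (i : ℕ) < n - 2 then L ⟨(i : ℕ), h⟩
    else if (i : ℕ) = n - 2 then x else y)

/-- `evalMinus F hn L r x y z` is `F(x, y, z, (L k)_{k ∈ [n-2] \ {r}})`: the last `n - 3`
arguments run through the collection `L` with the `r`-th member omitted. -/
noncomputable def evalMinus {V : Type*} [AddCommGroup V] [Module ℝ V] {n : ℕ}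
    (F : MultilinearMap ℝ (fun _ : Fin n => V) ℝ) (hn : 3 ≤ n)
    (L : Fin (n - 2) → V) (r : Fin (n - 2)) (x y z : V) : ℝ :=
  F (fun i =>
    if (i : ℕ) = 0 then x
    else if (i : ℕ) = 1 then y
    else if (i : ℕ) = 2 then z
    else if h : (i : ℕ) - 3 < (r : ℕ) then L ⟨(i : ℕ) - 3, by have := r.isLt; omega⟩
    else L ⟨(i : ℕ) - 2, by have := i.isLt; omega⟩)

open Set Function

section BilinearForms

variable {V : Type*} [AddCommGroup V] [Module ℝ V]

/-- The reverse Cauchy-Schwarz inequality: for symmetric `Q` it says that `Q` has at most one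
positive eigenvalue. -/
def ReverseCauchySchwarz (Q : LinearMap.BilinForm ℝ V) : Prop :=
  ∀ x y, 0 < Q x x → Q x x * Q y y ≤ Q x y ^ 2

theorem reverseCauchySchwarz_of_finrank_le_one {Q : LinearMap.BilinForm ℝ V}
    (hsymm : ∀ x y, Q x y = Q y x)
    (hQ : ∀ W : Submodule ℝ V, (∀ x ∈ W, x ≠ 0 → 0 < Q x x) → Module.finrank ℝ W ≤ 1) :
    ReverseCauchySchwarz Q := by
  intro x y hx
  by_contra! h
  have expand : ∀ a b : ℝ, Q x x * Q (a • x + b • y) (a • x + b • y) =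
      (a * Q x x + b * Q x y) ^ 2 + b ^ 2 * (Q x x * Q y y - Q x y ^ 2) := by
    intro a b
    simp only [map_add, map_smul, LinearMap.add_apply, LinearMap.smul_apply, smul_eq_mul]
    rw [hsymm y x]
    ring
  have pos : ∀ a b : ℝ, (a ≠ 0 ∨ b ≠ 0) → 0 < Q (a • x + b • y) (a • x + b • y) := by
    intro a b hab
    refine pos_of_mul_pos_right (a := Q x x) ?_ hx.le
    rw [expand]
    by_cases hb : b = 0
    · have ha : a ≠ 0 := by tauto
      subst hb
      have : 0 < (a * Q x x) ^ 2 := by positivity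
      simpa using this
    · have : 0 < b ^ 2 * (Q x x * Q y y - Q x y ^ 2) := mul_pos (by positivity) (by linarith)
      positivity
  have indep : LinearIndependent ℝ ![x, y] := by
    rw [LinearIndependent.pair_iff]
    intro a b hab
    by_contra hne
    have := pos a b (by tauto)
    simp [hab] at this
  have hrank := finrank_span_eq_card indep
  have := hQ (Submodule.span ℝ (range ![x, y])) (by
    intro z hz hz0
    rw [Matrix.range_cons, Matrix.range_cons, Matrix.range_empty, union_empty,
      singleton_union, Submodule.mem_span_pair] at hz
    obtain ⟨a, b, rfl⟩ := hz
    apply pos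
    by_contra! h0
    simp [h0.1, h0.2] at hz0)
  simp [hrank] at this

/-- If `Q` has at most one positive eigenvalue, then `Q` is negative semidefinite on the
orthogonal complement of any `x` outside the radical with `Q x x ≥ 0`. -/
theorem ReverseCauchySchwarz.nonpos_of_orthogonal {Q : LinearMap.BilinForm ℝ V}
    (hQ : ReverseCauchySchwarz Q) (hsymm : ∀ x y, Q x y = Q y x) {x z y : V}
    (hx : 0 ≤ Q x x) (hz : Q x z ≠ 0) (hy : Q x y = 0) : Q y y ≤ 0 := by
  by_contra! hpos
  have key : ∀ t : ℝ, Q y y * (Q x x + 2 * t * Q x z + t ^ 2 * Q z z) ≤ t ^ 2 * Q y z ^ 2 := by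
    intro t
    have := hQ y (x + t • z) hpos
    simp only [map_add, map_smul, LinearMap.add_apply, LinearMap.smul_apply, smul_eq_mul,
      hsymm y x, hy, hsymm z x] at this
    nlinarith
  have key2 : ∀ t : ℝ, 0 ≤ (Q y z ^ 2 - Q y y * Q z z) * (t * t) + (-(2 * Q y y * Q x z)) * t
      + 0 := by
    intro t
    nlinarith [key t, mul_nonneg hpos.le hx]
  have h3 := discrim_le_zero key2
  have : 0 < (2 * Q y y * Q x z) ^ 2 := by positivity
  simp only [discrim] at h3
  nlinarith

/-- Orthogonal projection with respect to a form that is negative semidefinite on a subspace. -/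
theorem exists_sub_mem_orthogonal [FiniteDimensional ℝ V] {S : LinearMap.BilinForm ℝ V}
    (hsymm : ∀ x y, S x y = S y x) {N K : Submodule ℝ V} (hKN : K ≤ N)
    (hN : ∀ x ∈ N, S x x ≤ 0) {a : V} (ha : a ∈ N) :
    ∃ b, b - a ∈ K ∧ ∀ d ∈ K, S b d = 0 := by
  let T : K →ₗ[ℝ] Module.Dual ℝ K := S.domRestrict₁₂ K K
  let f : Module.Dual ℝ K := (S a).domRestrict K
  have hf : f ∈ (LinearMap.ker T).dualAnnihilator := by
    rw [Submodule.mem_dualAnnihilator]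
    intro v hv
    have hvv : S v v = 0 := LinearMap.congr_fun (LinearMap.mem_ker.mp hv) v
    have key : ∀ t : ℝ, 0 ≤ 0 * (t * t) + (-(2 * S a v)) * t + (-S a a) := by
      intro t
      have := hN (a + t • (v : V)) (N.add_mem ha (N.smul_mem t (hKN v.2)))
      simp only [map_add, map_smul, LinearMap.add_apply, LinearMap.smul_apply, smul_eq_mul,
        hvv, hsymm v a] at this
      nlinarith
    have := discrim_le_zero key
    simp only [discrim] at this
    change S a v = 0
    nlinarith
  rw [← LinearMap.range_dualMap_eq_dualAnnihilator_ker] at hf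
  obtain ⟨φ, hφ⟩ := hf
  obtain ⟨k, rfl⟩ := (Module.evalEquiv ℝ K).surjective φ
  refine ⟨a - k, by simp, fun d hd => ?_⟩
  have h1 : S d k = S a d := LinearMap.congr_fun hφ ⟨d, hd⟩
  simp [hsymm k d, h1]

end BilinearForms

theorem MultilinearMap.continuous_of_finiteDimensional_real {ι V : Type*} [Fintype ι]
    [NormedAddCommGroup V] [NormedSpace ℝ V] [FiniteDimensional ℝ V]
    (F : MultilinearMap ℝ (fun _ : ι => V) ℝ) : Continuous F := by
  classical
  let b := Module.finBasis ℝ V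
  have h : ∀ v : ι → V, F v = ∑ j : ι → Fin (Module.finrank ℝ V),
      (∏ i, b.coord (j i) (v i)) • F fun i => b (j i) := by
    intro v
    conv_lhs => rw [show v = fun i => ∑ j, b.coord j (v i) • b j from
      funext fun i => (b.sum_repr (v i)).symm]
    rw [F.map_sum]
    exact Finset.sum_congr rfl fun j _ => F.map_smul_univ _ _
  have hc : ∀ j, Continuous (b.coord j) := fun j =>
    LinearMap.continuous_of_finiteDimensional _
  rw [show (F : (ι → V) → ℝ) = _ from funext h]
  fun_prop

section Cone

variable {V : Type*} [NormedAddCommGroup V] [NormedSpace ℝ V] {C : Set V}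

theorem LinearMap.eq_zero_of_nonneg_on_open [FiniteDimensional ℝ V] (hC : IsOpen C)
    (f : V →ₗ[ℝ] ℝ) (hf : ∀ x ∈ C, 0 ≤ f x) {w : V} (hw : w ∈ C) (hfw : f w = 0) : f = 0 := by
  have key : ∀ v, 0 ≤ f v := by
    intro v
    have hc : ContinuousAt (fun t : ℝ => w + t • v) 0 := by fun_prop
    have hev : ∀ᶠ t : ℝ in nhds 0, w + t • v ∈ C :=
      hc.eventually_mem (hC.mem_nhds (by simpa using hw))
    obtain ⟨t, ht, htpos⟩ := ((hev.filter_mono nhdsWithin_le_nhds).and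
      (self_mem_nhdsWithin : Ioi (0 : ℝ) ∈ nhdsWithin 0 (Ioi 0))).exists
    have := hf _ ht
    simp only [map_add, map_smul, hfw, zero_add, smul_eq_mul] at this
    exact nonneg_of_mul_nonneg_right this htpos
  ext v
  have h1 := key v
  have h2 := key (-v)
  rw [map_neg] at h2
  simp only [LinearMap.zero_apply]
  linarith

theorem add_mem_closure_of_cone (hconv : Convex ℝ C) (hcone : ∀ x ∈ C, ∀ t : ℝ, 0 < t → t • x ∈ C)
    {x y : V} (hx : x ∈ closure C) (hy : y ∈ closure C) : x + y ∈ closure C := by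
  refine map_mem_closure₂ continuous_add hx hy fun a ha b hb => ?_
  have := hcone _ (hconv ha hb (by norm_num : (0 : ℝ) ≤ 1 / 2) (by norm_num : (0 : ℝ) ≤ 1 / 2)
    (by norm_num)) 2 (by norm_num)
  simpa [smul_smul] using this

theorem zero_mem_closure_of_cone (hcone : ∀ x ∈ C, ∀ t : ℝ, 0 < t → t • x ∈ C)
    (hne : C.Nonempty) : (0 : V) ∈ closure C := by
  obtain ⟨w, hw⟩ := hne
  have hc : Filter.Tendsto (fun t : ℝ => t • w) (nhdsWithin 0 (Ioi 0)) (nhds 0) := by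
    have : Continuous fun t : ℝ => t • w := by fun_prop
    simpa using (this.tendsto 0).mono_left nhdsWithin_le_nhds
  exact mem_closure_of_tendsto hc
    (Filter.mem_of_superset self_mem_nhdsWithin fun t ht => hcone w hw t ht)

end Cone

theorem getD_cons_eq_update {V : Type*} {n : ℕ} (w : V) (hn : 1 ≤ n) (x : V) (l : List V) :
    (fun i : Fin n => (x :: l).getD i w) =
      update (fun i : Fin n => (w :: l).getD i w) ⟨0, hn⟩ x := by
  ext i
  by_cases h : i = ⟨0, hn⟩
  · simp [h]
  · rw [update_of_ne h]
    obtain ⟨_ | i, hi⟩ := i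
    · exact absurd rfl h
    · rfl

theorem getD_cons_cons_eq_update {V : Type*} {n : ℕ} (w : V) (hn : 2 ≤ n) (x y : V) (l : List V) :
    (fun i : Fin n => (x :: y :: l).getD i w) =
      update (fun i : Fin n => (x :: w :: l).getD i w) ⟨1, hn⟩ y := by
  ext i
  by_cases h : i = ⟨1, hn⟩
  · simp [h]
  · rw [update_of_ne h]
    obtain ⟨_ | _ | i, hi⟩ := i
    · rfl
    · exact absurd rfl h
    · rfl

section ListEval

variable {V : Type*} [AddCommGroup V] [Module ℝ V] {n : ℕ}
  (F : MultilinearMap ℝ (fun _ : Fin n => V) ℝ) (w : V)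

/-- `F` evaluated at the entries of `l`, padded with copies of `w`. -/
def listEval (l : List V) : ℝ := F fun i => l.getD i w

/-- `listEval` as a function of the first entry. -/
def headForm (hn : 1 ≤ n) (l : List V) : V →ₗ[ℝ] ℝ where
  toFun x := listEval F w (x :: l)
  map_add' x y := by
    simp only [listEval]
    rw [getD_cons_eq_update w hn (x + y), F.map_update_add,
      ← getD_cons_eq_update w hn, ← getD_cons_eq_update w hn]
  map_smul' c x := by
    simp only [listEval]
    rw [getD_cons_eq_update w hn (c • x), F.map_update_smul,
      ← getD_cons_eq_update w hn]
    rfl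

/-- `listEval` as a function of the first two entries. -/
def headBilinForm (hn : 2 ≤ n) (l : List V) : LinearMap.BilinForm ℝ V :=
  LinearMap.mk₂ ℝ (fun x y => listEval F w (x :: y :: l))
    (fun x x' y => (headForm F w (by omega) (y :: l)).map_add x x')
    (fun c x y => (headForm F w (by omega) (y :: l)).map_smul c x)
    (fun x y y' => by
      simp only [listEval]
      rw [getD_cons_cons_eq_update w hn x (y + y'), F.map_update_add,
        ← getD_cons_cons_eq_update w hn x, ← getD_cons_cons_eq_update w hn x])
    (fun c x y => by
      simp only [listEval]
      rw [getD_cons_cons_eq_update w hn x (c • y), F.map_update_smul,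
        ← getD_cons_cons_eq_update w hn x])

variable {F}

theorem listEval_perm (hsymm : ∀ (σ : Equiv.Perm (Fin n)) (v : Fin n → V), F (v ∘ σ) = F v)
    {l l' : List V} (h : l.Perm l') (hl : l.length ≤ n) : listEval F w l = listEval F w l' := by
  suffices ∀ p : List V, (p ++ l).length ≤ n →
      listEval F w (p ++ l) = listEval F w (p ++ l') by simpa using this [] (by simpa using hl)
  clear hl
  induction h with
  | nil => intros; rfl
  | cons x _ ih =>
    intro p hp
    simpa using ih (p ++ [x]) (by simpa using hp)
  | trans h₁ _ ih₁ ih₂ =>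
    intro p hp
    refine (ih₁ p hp).trans (ih₂ p ?_)
    simpa [h₁.length_eq] using hp
  | swap x y l =>
    intro p hp
    simp only [List.length_append, List.length_cons] at hp
    unfold listEval
    rw [← hsymm (Equiv.swap ⟨p.length, by omega⟩ ⟨p.length + 1, by omega⟩)]
    congr 1
    ext i
    simp only [comp_apply]
    by_cases h1 : i = ⟨p.length, by omega⟩
    · subst h1
      rw [Equiv.swap_apply_left]
      simp
    by_cases h2 : i = ⟨p.length + 1, by omega⟩
    · subst h2
      rw [Equiv.swap_apply_right]
      simp
    rw [Equiv.swap_apply_of_ne_of_ne h1 h2]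
    simp only [Fin.ext_iff] at h1 h2
    rcases lt_or_ge (i : ℕ) p.length with h | h
    · rw [List.getD_append _ _ _ _ h, List.getD_append _ _ _ _ h]
    · rw [List.getD_append_right _ _ _ _ h, List.getD_append_right _ _ _ _ h]
      obtain ⟨k, hk⟩ : ∃ k, (i : ℕ) - p.length = k + 2 := ⟨i - p.length - 2, by omega⟩
      simp [hk]

theorem listEval_append_self (l : List V) : listEval F w (l ++ [w]) = listEval F w l := by
  unfold listEval
  congr 1
  ext i
  rcases lt_or_ge (i : ℕ) l.length with h | h
  · rw [List.getD_append _ _ _ _ h]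
  · rw [List.getD_append_right _ _ _ _ h, List.getD_eq_default _ _ h]
    rcases (i : ℕ) - l.length with _ | k <;> simp

theorem listEval_cons_self
    (hsymm : ∀ (σ : Equiv.Perm (Fin n)) (v : Fin n → V), F (v ∘ σ) = F v)
    {l : List V} (hl : l.length < n) : listEval F w (w :: l) = listEval F w l := by
  rw [← listEval_append_self w l]
  exact listEval_perm w hsymm (List.perm_append_singleton w l).symm (by simpa using hl)

theorem listEval_sum_cons (hn : 1 ≤ n) (s l : List V) :
    listEval F w (s.sum :: l) = (s.map fun x => listEval F w (x :: l)).sum :=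
  map_list_sum (headForm F w hn l) s

theorem listEval_sum_cons_eq_zero (hn : 1 ≤ n) {s l : List V}
    (h : ∀ x ∈ s, listEval F w (x :: l) = 0) : listEval F w (s.sum :: l) = 0 := by
  rw [listEval_sum_cons w hn]
  exact List.sum_eq_zero (by simpa using h)

end ListEval

/-- `C`-Lorentzian symmetric multilinear forms. -/
structure IsLorentzian {V : Type*} [NormedAddCommGroup V] [NormedSpace ℝ V] (C : Set V) {n : ℕ}
    (F : MultilinearMap ℝ (fun _ : Fin n => V) ℝ) : Prop where
  isOpen : IsOpen C
  convex : Convex ℝ C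
  cone : ∀ x ∈ C, ∀ t : ℝ, 0 < t → t • x ∈ C
  symm : ∀ (σ : Equiv.Perm (Fin n)) (v : Fin n → V), F (v ∘ σ) = F v
  pos : ∀ v : Fin n → V, (∀ i, v i ∈ C) → 0 < F v
  finrank_le_one : ∀ v : Fin n → V, (∀ i : Fin n, 2 ≤ (i : ℕ) → v i ∈ C) →
    ∀ W : Submodule ℝ V, (∀ ξ ∈ W, ξ ≠ 0 → 0 < biEval F v ξ ξ) → Module.finrank ℝ W ≤ 1

namespace IsLorentzian

variable {V : Type*} [NormedAddCommGroup V] [NormedSpace ℝ V] {C : Set V} {n : ℕ}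
  {F : MultilinearMap ℝ (fun _ : Fin n => V) ℝ} {w : V}

theorem headBilinForm_symm (hF : IsLorentzian C F) (hn : 2 ≤ n) {l : List V}
    (hl : l.length + 2 ≤ n) (x y : V) :
    headBilinForm F w hn l x y = headBilinForm F w hn l y x :=
  listEval_perm w hF.symm (.swap y x l) (by simpa [Nat.succ_le_iff] using hl)

theorem listEval_nil_pos (hF : IsLorentzian C F) (hw : w ∈ C) : 0 < listEval F w [] :=
  hF.pos _ fun _ => by simpa using hw

theorem list_sum_mem_closure (hF : IsLorentzian C F) (hw : w ∈ C) {l : List V}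
    (hl : ∀ x ∈ l, x ∈ closure C) : l.sum ∈ closure C := by
  induction l with
  | nil => exact zero_mem_closure_of_cone hF.cone ⟨w, hw⟩
  | cons x l ih =>
    rw [List.forall_mem_cons] at hl
    rw [List.sum_cons]
    exact add_mem_closure_of_cone hF.convex hF.cone hl.1 (ih hl.2)

variable [FiniteDimensional ℝ V]

theorem listEval_nonneg (hF : IsLorentzian C F) (hw : w ∈ C) {l : List V}
    (hl : ∀ x ∈ l, x ∈ closure C) : 0 ≤ listEval F w l := by
  have hcont := F.continuous_of_finiteDimensional_real
  have hclosed : IsClosed {v | 0 ≤ F v} := isClosed_le continuous_const hcont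
  have hsub : univ.pi (fun _ : Fin n => C) ⊆ {v | 0 ≤ F v} := fun v hv =>
    (hF.pos v fun i => hv i (mem_univ i)).le
  have := closure_minimal hsub hclosed
  rw [closure_pi_set] at this
  refine this fun i _ => ?_
  rcases lt_or_ge (i : ℕ) l.length with h | h
  · rw [List.getD_eq_getElem _ _ h]
    exact hl _ (List.getElem_mem h)
  · rw [List.getD_eq_default _ _ h]
    exact subset_closure hw

/-- If `f ≥ 0` is a partial evaluation of `F` against nef vectors which vanishes at the interior
point `w`, then `f = 0`. -/
theorem headForm_eq_zero (hF : IsLorentzian C F) (hw : w ∈ C) (hn : 1 ≤ n) {l : List V}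
    (hl : ∀ x ∈ l, x ∈ closure C) (hlen : l.length < n) (h0 : listEval F w l = 0) :
    headForm F w hn l = 0 := by
  refine (headForm F w hn l).eq_zero_of_nonneg_on_open hF.isOpen (fun x hx => ?_) hw
    ((listEval_cons_self w hF.symm hlen).trans h0)
  exact hF.listEval_nonneg hw (by simpa [subset_closure hx] using hl)

theorem listEval_pos_of_cons (hF : IsLorentzian C F) (hw : w ∈ C) {x : V} {l : List V}
    (hl : ∀ x ∈ l, x ∈ closure C) (hlen : l.length < n) (h : 0 < listEval F w (x :: l)) :
    0 < listEval F w l := by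
  refine (hF.listEval_nonneg hw hl).lt_of_ne fun h0 => ?_
  have := LinearMap.congr_fun (hF.headForm_eq_zero hw (by omega) hl hlen h0.symm) x
  exact h.ne' this

theorem reverseCauchySchwarz (hF : IsLorentzian C F) (hw : w ∈ C) (hn : 2 ≤ n) {l : List V}
    (hl : ∀ x ∈ l, x ∈ closure C) :
    ReverseCauchySchwarz (headBilinForm F w hn l) := by
  intro x y
  have hcont := F.continuous_of_finiteDimensional_real
  have hc : ∀ x y, Continuous fun v : Fin n → V => biEval F v x y := by
    intro x y
    refine hcont.comp (continuous_pi fun i => ?_)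
    split_ifs <;> fun_prop
  have hclosed : IsClosed {v : Fin n → V |
      biEval F v x x ≤ 0 ∨ biEval F v x x * biEval F v y y ≤ biEval F v x y ^ 2} :=
    (isClosed_le (hc x x) continuous_const).union
      (isClosed_le ((hc x x).mul (hc y y)) ((hc x y).pow 2))
  have bridge : ∀ (v : Fin n → V) (x y : V),
      biEval F v x y = headBilinForm F (v ⟨0, by omega⟩) hn ((List.ofFn v).drop 2) x y := by
    intro v x y
    change F _ = F _
    congr 1
    ext ⟨i, hi⟩
    rcases i with _ | _ | i
    · simp
    · simp
    · simp [List.getD_eq_getElem?_getD, List.getElem?_drop, add_comm 2 i, hi]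
  have hsub : univ.pi (fun _ : Fin n => C) ⊆ {v : Fin n → V |
      biEval F v x x ≤ 0 ∨ biEval F v x x * biEval F v y y ≤ biEval F v x y ^ 2} := by
    intro v hv
    rw [mem_ofPred_eq, or_iff_not_imp_left, not_le]
    have hv' := hF.finrank_le_one v fun i _ => hv i (mem_univ i)
    simp only [bridge] at hv' ⊢
    exact reverseCauchySchwarz_of_finrank_le_one (hF.headBilinForm_symm hn (by simp; omega)) hv' x y
  have := closure_minimal hsub hclosed
  rw [closure_pi_set] at this
  have hmem := this (show (fun i : Fin n => (w :: w :: l).getD i w) ∈ _ by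
    intro i _
    rcases lt_or_ge (i : ℕ) (w :: w :: l).length with h | h
    · simp only [List.getD_eq_getElem _ _ h]
      have hl' : ∀ x ∈ w :: w :: l, x ∈ closure C := by simpa [subset_closure hw] using hl
      exact hl' _ (List.getElem_mem h)
    · simp only [List.getD_eq_default _ _ h]
      exact subset_closure hw)
  have heq : ∀ x y, biEval F (fun i : Fin n => (w :: w :: l).getD i w) x y =
      headBilinForm F w hn l x y := by
    intro x y
    change F _ = F _
    congr 1
    ext ⟨i, hi⟩
    rcases i with _ | _ | i <;> simp
  simp only [mem_ofPred_eq, heq] at hmem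
  exact fun h => hmem.resolve_left h.not_ge

theorem headBilinForm_nonneg (hF : IsLorentzian C F) (hw : w ∈ C) (hn : 2 ≤ n) {l : List V}
    (hl : ∀ x ∈ l, x ∈ closure C) {x y : V} (hx : x ∈ closure C) (hy : y ∈ closure C) :
    0 ≤ headBilinForm F w hn l x y :=
  hF.listEval_nonneg hw (by simpa [hx, hy] using hl)

/-- The transitivity of parallelism underlying the matroid structure on supports. -/
theorem listEval_self_self_eq_zero (hF : IsLorentzian C F) (hw : w ∈ C) {l : List V}
    (hl : ∀ x ∈ l, x ∈ closure C) (hlen : l.length + 2 ≤ n) {x y : V} (hx : x ∈ closure C)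
    (hy : y ∈ closure C) (hpos : 0 < listEval F w (y :: l))
    (hxy : listEval F w (y :: x :: l) = 0) : listEval F w (x :: x :: l) = 0 := by
  have hn : 2 ≤ n := by omega
  have hyw : headBilinForm F w hn l y w ≠ 0 := by
    rw [hF.headBilinForm_symm hn hlen]
    refine ne_of_gt (lt_of_lt_of_eq hpos (listEval_cons_self w hF.symm ?_).symm)
    simp; omega
  exact ((hF.reverseCauchySchwarz hw hn hl).nonpos_of_orthogonal (hF.headBilinForm_symm hn hlen)
    (hF.headBilinForm_nonneg hw hn hl hy hy) hyw hxy).antisymm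
      (hF.headBilinForm_nonneg hw hn hl hx hx)

theorem listEval_cons_le_sum_cons (hF : IsLorentzian C F) (hw : w ∈ C) (hn : 1 ≤ n) {s l : List V}
    (hs : ∀ x ∈ s, x ∈ closure C) (hl : ∀ x ∈ l, x ∈ closure C) {x : V} (hx : x ∈ s) :
    listEval F w (x :: l) ≤ listEval F w (s.sum :: l) := by
  rw [listEval_sum_cons w hn]
  refine List.single_le_sum ?_ _ (List.mem_map_of_mem hx)
  simp only [List.mem_map, forall_exists_index, and_imp, forall_apply_eq_imp_iff₂]
  intro y hy
  exact hF.listEval_nonneg hw (by simpa [hs y hy] using hl)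

/-- For a minimal dependent list `s`, members of `s` may be traded for copies of the sum of `s`. -/
theorem exchange_sum (hF : IsLorentzian C F) (hw : w ∈ C) {s : List V}
    (hs : ∀ x ∈ s, x ∈ closure C) (hlen : s.length ≤ n) (h0 : listEval F w s = 0)
    (hmin : ∀ t : List V, t.Subperm s → t.length < s.length → 0 < listEval F w t) (a : ℕ) :
    ∀ b : List V, b.Subperm s → b.length + a + 1 = s.length →
      0 < listEval F w (b ++ List.replicate a s.sum) ∧
      ∀ x ∈ s, listEval F w (x :: (b ++ List.replicate a s.sum)) = 0 := by
  classical
  have hsum := hF.list_sum_mem_closure hw hs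
  have mem_s : ∀ {b : List V}, b.Subperm s → ∀ x ∈ b, x ∈ closure C := fun hb x hx =>
    hs x (hb.subset hx)
  induction a with
  | zero =>
    intro b hb hlb
    have hpos := hmin b hb (by omega)
    simp only [List.replicate_zero, List.append_nil]
    refine ⟨hpos, fun x hx => ?_⟩
    obtain ⟨j, hj⟩ : ∃ j, (j :: b).Perm s := by
      obtain ⟨j, hj⟩ := List.Subperm.exists_of_length_lt hb (by omega)
      exact ⟨j, hj.perm_of_length_le (by simp; omega)⟩
    have hjb : listEval F w (j :: b) = 0 := by
      rw [listEval_perm w hF.symm hj (by rw [hj.length_eq]; exact hlen), h0]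
    rcases List.mem_cons.mp (hj.mem_iff.mpr hx) with rfl | hxb
    · exact hjb
    obtain ⟨c, hc⟩ : ∃ c, b.Perm (x :: c) := ⟨_, List.perm_cons_erase hxb⟩
    have hcl := hc.length_eq
    simp only [List.length_cons] at hcl
    have hjc : (j :: c).Subperm s := by
      refine List.Subperm.trans ?_ hj.subperm
      exact (List.subperm_cons j).mpr ((List.sublist_cons_self x c).subperm.trans hc.symm.subperm)
    rw [listEval_perm w hF.symm (hc.cons x) (by simp; omega)]
    refine hF.listEval_self_self_eq_zero hw (fun y hy => mem_s hb y (hc.mem_iff.mpr (by simp [hy])))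
      (by omega) (hs x hx) (mem_s hjc j (by simp)) (hmin _ hjc (by simp; omega)) ?_
    rw [← listEval_perm w hF.symm (hc.cons j) (by simp; omega), hjb]
  | succ a ih =>
    intro b hb hlb
    obtain ⟨j, hj⟩ : ∃ j, (j :: b).Subperm s := List.Subperm.exists_of_length_lt hb (by omega)
    obtain ⟨hpos, hzero⟩ := ih (j :: b) hj (by simp; omega)
    rw [List.cons_append] at hpos hzero
    set A := b ++ List.replicate a s.sum with hA
    have hAlen : A.length + 2 = s.length := by simp [hA]; omega
    have hAmem : ∀ x ∈ A, x ∈ closure C := by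
      intro x hx
      rcases List.mem_append.mp hx with hx | hx
      · exact mem_s hb x hx
      · rw [List.eq_of_mem_replicate hx]
        exact hsum
    have hjs : j ∈ s := hj.subset (by simp)
    have hn : 1 ≤ n := by omega
    have hperm : (b ++ List.replicate (a + 1) s.sum).Perm (s.sum :: A) := by
      rw [List.replicate_succ]
      exact List.perm_middle
    have hzero' : listEval F w (s.sum :: s.sum :: A) = 0 := by
      refine hF.listEval_self_self_eq_zero hw hAmem (by omega) hsum (hs j hjs) hpos ?_
      rw [listEval_perm w hF.symm (.swap _ _ _) (by simp; omega)]
      exact listEval_sum_cons_eq_zero w hn hzero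
    have hSmem : ∀ x ∈ s.sum :: A, x ∈ closure C := by simpa [hsum] using hAmem
    constructor
    · rw [listEval_perm w hF.symm hperm (by rw [hperm.length_eq]; simp; omega)]
      exact hpos.trans_le (hF.listEval_cons_le_sum_cons hw hn hs hAmem hjs)
    · intro x hx
      rw [listEval_perm w hF.symm (hperm.cons x)
        (by rw [(hperm.cons x).length_eq]; simp; omega)]
      exact ((hF.listEval_cons_le_sum_cons hw hn hs hSmem hx).trans hzero'.le).antisymm
        (hF.listEval_nonneg hw (by simpa [hs x hx] using hSmem))

/-- Rado-type theorem: a list of nef vectors on which `F` vanishes contains a nonempty part whose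
sum has too small numerical dimension. -/
theorem exists_subperm_replicate_eq_zero (hF : IsLorentzian C F) (hw : w ∈ C) {s : List V}
    (hs : ∀ x ∈ s, x ∈ closure C) (hlen : s.length ≤ n) (h0 : listEval F w s = 0) :
    ∃ t : List V, t.Subperm s ∧ t ≠ [] ∧ listEval F w (List.replicate t.length t.sum) = 0 := by
  induction hk : s.length using Nat.strong_induction_on generalizing s with
  | _ k ih =>
  subst hk
  by_cases hmin : ∀ t : List V, t.Subperm s → t.length < s.length → 0 < listEval F w t
  · rcases s with _ | ⟨x, s⟩
    · exact absurd h0 (hF.listEval_nil_pos hw).ne'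
    refine ⟨x :: s, List.Subperm.refl _, by simp, ?_⟩
    have := (hF.exchange_sum hw hs hlen h0 hmin s.length [] (List.nil_subperm) (by simp)).2
    exact listEval_sum_cons_eq_zero w (by simp at hlen; omega) this
  · push Not at hmin
    obtain ⟨t, ht, htlen, ht0⟩ := hmin
    have htmem : ∀ x ∈ t, x ∈ closure C := fun x hx => hs x (ht.subset hx)
    obtain ⟨u, hu, hne, hu0⟩ := ih t.length htlen htmem (by omega)
      (ht0.antisymm (hF.listEval_nonneg hw htmem)) rfl
    exact ⟨u, hu.trans ht, hne, hu0⟩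

theorem listEval_replicate_pos (hF : IsLorentzian C F) (hw : w ∈ C) {v : V} (hv : v ∈ closure C)
    {k : ℕ} (hk : k ≤ numDim F w v) : 0 < listEval F w (List.replicate k v) := by
  have heq : ∀ k, F (fun i => if (i : ℕ) < k then v else w) =
      listEval F w (List.replicate k v) := by
    intro k
    unfold listEval
    congr 1
    ext i
    split_ifs with h
    · simp [h]
    · rw [List.getD_eq_default _ _ (by simpa using h)]
  have hmem : numDim F w v ∈ {k : ℕ | k ≤ n ∧ 0 < F (fun i => if (i : ℕ) < k then v else w)} := by
    refine Nat.sSup_mem ⟨0, by simp, ?_⟩ ⟨n, fun k hk => hk.1⟩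
    rw [heq]
    exact hF.listEval_nil_pos hw
  obtain ⟨hle, hpos⟩ := hmem
  rw [heq] at hpos
  induction hk using Nat.decreasingInduction with
  | self => exact hpos
  | of_succ k hk ih =>
    refine hF.listEval_pos_of_cons hw (x := v) ?_ (by simp; omega) ih
    intro x hx
    rwa [List.eq_of_mem_replicate hx]

/-- A collection with `|I| ≤ nd(∑ i ∈ I, L i)` for all nonempty `I` has positive mixed value. -/
theorem listEval_ofFn_pos (hF : IsLorentzian C F) (hw : w ∈ C) {m : ℕ} (hm : m ≤ n) {L : Fin m → V}
    (hL : ∀ i, L i ∈ closure C)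
    (hdim : ∀ I : Finset (Fin m), I.Nonempty → I.card ≤ numDim F w (∑ i ∈ I, L i)) :
    0 < listEval F w (List.ofFn L) := by
  have hs : ∀ x ∈ List.ofFn L, x ∈ closure C := by simpa [List.forall_mem_ofFn_iff] using hL
  refine (hF.listEval_nonneg hw hs).lt_of_ne fun h0 => ?_
  obtain ⟨t, ht, hne, ht0⟩ := hF.exists_subperm_replicate_eq_zero hw hs (by simpa using hm) h0.symm
  obtain ⟨t', htt', ht'⟩ := ht
  rw [List.ofFn_eq_map, List.sublist_map_iff] at ht'
  obtain ⟨u, hu, rfl⟩ := ht'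
  have hnodup : u.Nodup := hu.nodup (List.nodup_finRange m)
  have hsum : ∑ i ∈ u.toFinset, L i = t.sum := by
    rw [List.sum_toFinset _ hnodup, htt'.sum_eq]
  have hcard : u.toFinset.card = t.length := by
    rw [List.toFinset_card_of_nodup hnodup, ← htt'.length_eq, List.length_map]
  have hI : u.toFinset.Nonempty := by
    rw [← Finset.card_pos, hcard]
    exact List.length_pos_iff.mpr hne
  have htmem : t.sum ∈ closure C := hF.list_sum_mem_closure hw fun x hx => by
    obtain ⟨i, -, rfl⟩ := List.mem_map.mp (htt'.mem_iff.mpr hx)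
    exact hL i
  have := hdim _ hI
  rw [hsum, hcard] at this
  exact (hF.listEval_replicate_pos hw htmem this).ne' ht0

end IsLorentzian

section Evaluation

variable {V : Type*} [AddCommGroup V] [Module ℝ V] {n : ℕ}
  {F : MultilinearMap ℝ (fun _ : Fin n => V) ℝ} (w : V)

theorem evalKer_eq_listEval (hn : 2 ≤ n) (L : Fin (n - 2) → V) (x y : V) :
    evalKer F L x y = listEval F w (List.ofFn L ++ [x, y]) := by
  unfold evalKer listEval
  congr 1
  ext i
  have hlen : (List.ofFn L).length = n - 2 := List.length_ofFn
  by_cases h : (i : ℕ) < n - 2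
  · rw [dif_pos h, List.getD_append _ _ _ _ (by omega), List.getD_eq_getElem _ _ (by omega),
      List.getElem_ofFn]
  · rw [dif_neg h, List.getD_append_right _ _ _ _ (by omega), hlen]
    by_cases h' : (i : ℕ) = n - 2
    · simp [h']
    · have : (i : ℕ) - (n - 2) = 1 := by omega
      simp [h', this]

theorem evalMinus_eq_listEval (hn : 3 ≤ n) (L : Fin (n - 2) → V) (r : Fin (n - 2)) (x y z : V) :
    evalMinus F hn L r x y z = listEval F w (x :: y :: z :: (List.ofFn L).eraseIdx r) := by
  unfold evalMinus listEval
  congr 1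
  ext ⟨i, hi⟩
  rcases i with _ | _ | _ | i
  · simp
  · simp
  · simp
  · have hlen : i < ((List.ofFn L).eraseIdx r).length := by
      rw [List.length_eraseIdx_of_lt (by simp), List.length_ofFn]
      omega
    simp only [List.getD_cons_succ]
    rw [List.getD_eq_getElem _ _ hlen, List.getElem_eraseIdx]
    rw [if_neg (by omega), if_neg (by omega), if_neg (by omega)]
    simp only [List.getElem_ofFn]
    rfl

end Evaluation

/-- A partial evaluation of `F` which is nonnegative on nef vectors and has the interior point `w`
in its radical vanishes identically. -/
theorem IsLorentzian.headBilinForm_eq_zero {V : Type*} [NormedAddCommGroup V] [NormedSpace ℝ V]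
    [FiniteDimensional ℝ V] {C : Set V} {n : ℕ} {F : MultilinearMap ℝ (fun _ : Fin n => V) ℝ}
    {w : V} (hF : IsLorentzian C F) (hw : w ∈ C) (hn : 2 ≤ n) {l : List V}
    (hlen : l.length + 2 ≤ n)
    (hnonneg : ∀ x ∈ C, ∀ y ∈ C, 0 ≤ headBilinForm F w hn l x y)
    (h0 : headBilinForm F w hn l w = 0) : headBilinForm F w hn l = 0 := by
  have hsymm := hF.headBilinForm_symm (w := w) hn hlen
  have hC : ∀ x ∈ C, headBilinForm F w hn l x = 0 := fun x hx =>
    LinearMap.eq_zero_of_nonneg_on_open hF.isOpen _ (hnonneg x hx) hw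
      ((hsymm x w).trans (LinearMap.congr_fun h0 x))
  ext x y
  rw [hsymm]
  refine LinearMap.congr_fun (LinearMap.eq_zero_of_nonneg_on_open hF.isOpen
    ((headBilinForm F w hn l).flip x) (fun z hz => ?_) hw ?_) y
  · simp [hC z hz]
  · simp [h0]

/-- (Local Hodge index inequality for Lorentzian polynomials.)
Let `F` be a `C`-Lorentzian symmetric `n`-multilinear form (`n ≥ 3`) on a finite-dimensional
real vector space `V`, `Eff` a closed convex cone containing the closure of `C` on which `F`
is nonnegative against nef classes, `L₁, ..., L_{n-2}` a critical collection of nef classes,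
and `𝒞 ⊆ Eff` a generating set: its closed convex cone hull is `Eff`, `𝒞 ∩ ker 𝔏` is finite,
and products with members of `𝒞` have the weak Hodge–Riemann property. Fix `r ∈ [n-2]`. Then
for every `α ∈ ker 𝔏` there is `β` with `β - α ∈ span(𝒞 ∩ ker 𝔏)` and
`F(β, β, T, 𝔏_{\ r}) ≤ 0` for every `T ∈ Eff`. -/
theorem local_hodge_index_inequality
    {V : Type*} [NormedAddCommGroup V] [NormedSpace ℝ V] [FiniteDimensional ℝ V]
    {n : ℕ} (hn : 3 ≤ n)
    (C : Set V) (hCne : C.Nonempty) (hCopen : IsOpen C) (hCconv : Convex ℝ C)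
    (hCcone : ∀ x ∈ C, ∀ t : ℝ, 0 < t → t • x ∈ C)
    (F : MultilinearMap ℝ (fun _ : Fin n => V) ℝ)
    (hFsymm : ∀ (σ : Equiv.Perm (Fin n)) (v : Fin n → V), F (v ∘ σ) = F v)
    (hFpos : ∀ v : Fin n → V, (∀ i, v i ∈ C) → 0 < F v)
    (hFlor : ∀ v : Fin n → V, (∀ i : Fin n, 2 ≤ (i : ℕ) → v i ∈ C) →
      (∃ ξ : V, 0 < biEval F v ξ ξ) ∧
      ∀ W : Submodule ℝ V, (∀ ξ ∈ W, ξ ≠ 0 → 0 < biEval F v ξ ξ) →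
        Module.finrank ℝ W ≤ 1)
    (Eff : Set V) (hEffClosed : IsClosed Eff) (hEffConv : Convex ℝ Eff)
    (hEffCone : ∀ x ∈ Eff, ∀ t : ℝ, 0 < t → t • x ∈ Eff)
    (hCEff : closure C ⊆ Eff)
    (hEffNonneg : ∀ v : Fin n → V, v ⟨0, by omega⟩ ∈ Eff →
      (∀ i : Fin n, (i : ℕ) ≠ 0 → v i ∈ closure C) → 0 ≤ F v)
    (L : Fin (n - 2) → V) (hL : ∀ i, L i ∈ closure C)
    (w : V) (hw : w ∈ C)
    (hcrit : ∀ I : Finset (Fin (n - 2)), I.Nonempty →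
      I.card + 1 ≤ numDim F w (∑ i ∈ I, L i))
    (𝒞 : Set V) (h𝒞Eff : 𝒞 ⊆ Eff)
    (hGen : closure {x : V | ∃ (s : Finset V) (c : V → ℝ),
      (∀ v ∈ s, 0 ≤ c v ∧ v ∈ 𝒞) ∧ x = ∑ v ∈ s, c v • v} = Eff)
    (hFin : (𝒞 ∩ {η : V | ∀ v : V, evalKer F L η v = 0}).Finite)
    (hHR : ∀ D ∈ 𝒞, ∀ v : Fin n → V, (∀ i : Fin n, 3 ≤ (i : ℕ) → v i ∈ closure C) →
      ∀ W : Submodule ℝ V, (∀ x ∈ W, x ≠ 0 → 0 < triEval F v D x x) →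
        Module.finrank ℝ W ≤ 1)
    (r : Fin (n - 2))
    (α : V) (hα : ∀ v : V, evalKer F L α v = 0) :
    ∃ β : V,
      β - α ∈ Submodule.span ℝ (𝒞 ∩ {η : V | ∀ v : V, evalKer F L η v = 0}) ∧
      ∀ T ∈ Eff, evalMinus F hn L r β β T ≤ 0 := by
  have hn2 : 2 ≤ n := by omega
  have hF : IsLorentzian C F := ⟨hCopen, hCconv, hCcone, hFsymm, hFpos, fun v hv => (hFlor v hv).2⟩
  have hCcl : ∀ x ∈ C, x ∈ closure C := fun x hx => subset_closure hx
  have hwcl := hCcl w hw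
  set M : List V := (List.ofFn L).eraseIdx r with hM
  have hMlen : M.length + 3 = n := by
    rw [hM, List.length_eraseIdx_of_lt (by simp)]
    have := r.isLt
    simp
    omega
  have hMcl : ∀ x ∈ M, x ∈ closure C := by
    intro x hx
    obtain ⟨i, rfl⟩ := List.mem_ofFn.mp (List.mem_of_mem_eraseIdx hx)
    exact hL i
  have hperm : (L r :: M).Perm (List.ofFn L) := by
    have := List.getElem_cons_eraseIdx_perm (l := List.ofFn L) (n := r) (by simp)
    simpa using this
  let B : V → LinearMap.BilinForm ℝ V := fun T => headBilinForm F w hn2 (T :: M)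
  have hBsymm : ∀ T x y, B T x y = B T y x := fun T x y =>
    hF.headBilinForm_symm hn2 (by simp; omega) x y
  have hBrot : ∀ T x y, B T x y = B y x T := fun T x y =>
    listEval_perm w hFsymm ((List.Perm.swap T y M).cons x) (by simp; omega)
  have hker : ∀ x y, evalKer F L x y = B (L r) x y := by
    intro x y
    rw [evalKer_eq_listEval w hn2]
    refine listEval_perm w hFsymm ?_ (by simp; omega)
    exact List.perm_append_comm.trans ((hperm.symm.cons y).cons x)
  have hminus : ∀ x y T, evalMinus F hn L r x y T = B T x y :=
    fun x y T => evalMinus_eq_listEval w hn L r x y T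
  have hBnonneg : ∀ T ∈ Eff, ∀ x ∈ closure C, ∀ y ∈ closure C, 0 ≤ B T x y := by
    intro T hT x hx y hy
    rw [hBrot, hBsymm]
    refine hEffNonneg _ (by simpa using hT) ?_
    rintro ⟨_ | i, hi⟩ h0
    · exact absurd rfl h0
    · have hmem : ∀ z ∈ x :: y :: M, z ∈ closure C := by simpa [hx, hy] using hMcl
      have him : i < (x :: y :: M).length := by simp; omega
      rw [List.getD_cons_succ, List.getD_eq_getElem _ _ him]
      exact hmem _ (List.getElem_mem him)
  -- the kernel of `𝔏`
  let N : Submodule ℝ V := LinearMap.ker (B (L r))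
  have hN : ∀ η, η ∈ N ↔ ∀ v, evalKer F L η v = 0 := by
    intro η
    simp only [hker]
    exact ⟨fun h v => LinearMap.congr_fun (LinearMap.mem_ker.mp h) v,
      fun h => LinearMap.mem_ker.mpr (LinearMap.ext h)⟩
  have hpos : 0 < listEval F w (List.ofFn L) :=
    hF.listEval_ofFn_pos hw (by omega) hL fun I hI => (Nat.le_succ _).trans (hcrit I hI)
  have hLw : B w (L r) w ≠ 0 := by
    rw [hBsymm]
    refine ne_of_gt (hpos.trans_eq ?_)
    rw [← listEval_perm w hFsymm hperm (by simp; omega)]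
    change _ = listEval F w (w :: L r :: w :: M)
    rw [listEval_cons_self w hFsymm (by simp; omega),
      listEval_perm w hFsymm (.swap _ _ _) (by simp; omega),
      listEval_cons_self w hFsymm (by simp; omega)]
  have hLker : ∀ T, ∀ η ∈ N, B T (L r) η = 0 := by
    intro T η hη
    rw [hBsymm, hBrot]
    exact LinearMap.congr_fun (LinearMap.mem_ker.mp hη) T
  have hwN : ∀ η ∈ N, B w η η ≤ 0 := fun η hη =>
    (hF.reverseCauchySchwarz hw hn2 (by simpa [hwcl] using hMcl)).nonpos_of_orthogonal (hBsymm w)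
      (hBnonneg w (hCEff hwcl) _ (hL r) _ (hL r)) hLw (hLker w η hη)
  have hKN : Submodule.span ℝ (𝒞 ∩ {η : V | ∀ v : V, evalKer F L η v = 0}) ≤ N :=
    Submodule.span_le.mpr fun η hη => (hN η).mpr hη.2
  obtain ⟨β, hβα, hβ⟩ := exists_sub_mem_orthogonal (hBsymm w) hKN hwN ((hN α).mpr hα)
  have hβN : β ∈ N := by
    have := N.add_mem (hKN hβα) ((hN α).mpr hα)
    simpa using this
  refine ⟨β, hβα, ?_⟩
  have hgen : ∀ D ∈ 𝒞, B D β β ≤ 0 := by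
    intro D hD
    have hDEff := h𝒞Eff hD
    have hrcs : ReverseCauchySchwarz (B D) := by
      refine reverseCauchySchwarz_of_finrank_le_one (hBsymm D) fun W hW => ?_
      refine hHR D hD (fun i => (w :: w :: D :: M).getD i w) ?_ W ?_
      · rintro ⟨i, hi⟩ h3
        obtain ⟨i, rfl⟩ : ∃ j, i = j + 3 := ⟨i - 3, by simp at h3; omega⟩
        have him : i < M.length := by omega
        simp only [List.getD_cons_succ]
        rw [List.getD_eq_getElem _ _ him]
        exact hMcl _ (List.getElem_mem him)
      · intro x hx hx0
        refine (hW x hx hx0).trans_eq ?_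
        change F _ = F _
        congr 1
        ext ⟨i, hi⟩
        rcases i with _ | _ | _ | i <;> simp
    by_cases hDN : D ∈ N
    · by_cases h0 : B D w = 0
      · have : B D = 0 := hF.headBilinForm_eq_zero hw hn2 (by simp; omega)
          (fun x hx y hy => hBnonneg D hDEff x (hCcl x hx) y (hCcl y hy)) h0
        simp [this]
      · obtain ⟨z, hz⟩ : ∃ z, B D w z ≠ 0 := by
          by_contra! h
          exact h0 (LinearMap.ext h)
        refine hrcs.nonpos_of_orthogonal (hBsymm D) (hBnonneg D hDEff w hwcl w hwcl) hz ?_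
        rw [hBsymm, hBrot]
        exact hβ D (Submodule.subset_span ⟨hD, (hN D).mp hDN⟩)
    · obtain ⟨z, hz⟩ : ∃ z, B (L r) D z ≠ 0 := by
        by_contra! h
        exact hDN (LinearMap.mem_ker.mpr (LinearMap.ext h))
      refine hrcs.nonpos_of_orthogonal (hBsymm D) (z := z)
        (hBnonneg D hDEff _ (hL r) _ (hL r)) ?_ (hLker D β hβN)
      rwa [hBsymm, hBrot, hBsymm]
  have hlin : ∀ T, B T β β = (B β β) T := fun T => hBrot T β β
  have hclosed : IsClosed {T : V | B β β T ≤ 0} :=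
    isClosed_le (LinearMap.continuous_of_finiteDimensional _) continuous_const
  intro T hT
  rw [hminus, hlin]
  rw [← hGen] at hT
  refine closure_minimal ?_ hclosed hT
  rintro _ ⟨s, c, hs, rfl⟩
  change B β β _ ≤ 0
  rw [map_sum]
  refine Finset.sum_nonpos fun D hD => ?_
  rw [map_smul, ← hlin, smul_eq_mul]
  exact mul_nonpos_of_nonneg_of_nonpos (hs D hD).1 (hgen D (hs D hD).2)
end

section
/- Let F be a C-Lorentzian symmetric n-multilinear form (n ≥ 3) on a finite-dimensional real vector space V, where C ⊆ V is a nonempty open convex cone with closure C̄. Let Eff ⊆ V be a closed convex cone with C̄ ⊆ Eff such that F(T, α₁, ..., α_{n−1}) ≥ 0 for every T ∈ Eff and all α₁, ..., α_{n−1} ∈ C̄. Let L₁, ..., L_{n−2} ∈ C̄ be a critical collection, i.e. nd(L_I) ≥ |I| + 1 for every nonempty I ⊆ [n−2], and set ker 𝔏 = {η ∈ V : F(L₁,...,L_{n−2}, η, v) = 0 for all v ∈ V}. Let 𝒞 ⊆ Eff satisfy: (i) the closed convex cone generated by 𝒞 equals Eff; (ii) 𝒞 ∩ ker 𝔏 is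 finite; (iii) for every D ∈ 𝒞 and all α₁, ..., α_{n−3} ∈ C̄, the symmetric bilinear form (x,y) ↦ F(x, y, D, α₁, ..., α_{n−3}) has at most one positive eigenvalue. Fix r ∈ [n−2] and A ∈ C. Then for every α ∈ ker 𝔏 there exists β ∈ V such that β − α lies in the linear span of 𝒞 ∩ ker 𝔏 and F(D, β, A, (L_k)_{k∈[n−2]∖{r}}) = 0 for every D ∈ 𝒞 ∩ ker 𝔏. -/
/-- The bilinear form obtained from `F` by freezing every argument of `v` except `i` and `j`. -/
noncomputable def slotForm {V : Type*} [AddCommGroup V] [Module ℝ V] {n : ℕ}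
    (F : MultilinearMap ℝ (fun _ : Fin n => V) ℝ) (v : Fin n → V) {i j : Fin n} (hij : i ≠ j) :
    V →ₗ[ℝ] V →ₗ[ℝ] ℝ :=
  LinearMap.mk₂ ℝ (fun x y => F (Function.update (Function.update v i x) j y))
    (fun x x' y => by simp [Function.update_comm hij])
    (fun c x y => by simp [Function.update_comm hij])
    (fun x y y' => by simp)
    (fun c x y => by simp)

theorem slotForm_apply {V : Type*} [AddCommGroup V] [Module ℝ V] {n : ℕ}
    (F : MultilinearMap ℝ (fun _ : Fin n => V) ℝ) (v : Fin n → V) {i j : Fin n} (hij : i ≠ j)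
    (x y : V) : slotForm F v hij x y = F (Function.update (Function.update v i x) j y) := rfl

theorem slotForm_comm {V : Type*} [AddCommGroup V] [Module ℝ V] {n : ℕ}
    (F : MultilinearMap ℝ (fun _ : Fin n => V) ℝ)
    (hF : ∀ (σ : Equiv.Perm (Fin n)) (v : Fin n → V), F (v ∘ σ) = F v)
    (v : Fin n → V) {i j : Fin n} (hij : i ≠ j) (x y : V) :
    slotForm F v hij x y = slotForm F v hij y x := by
  rw [slotForm_apply, slotForm_apply, ← hF (Equiv.swap i j)]
  congr 1
  funext k
  simp only [Function.comp_apply, Function.update_apply, Equiv.swap_apply_def]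
  split_ifs <;> simp_all

/-- A positive-definite plane is excluded by the reversed Cauchy-Schwarz inequality. -/
theorem mul_le_sq_of_finrank_le_one {V : Type*} [AddCommGroup V] [Module ℝ V]
    [FiniteDimensional ℝ V] (B : V →ₗ[ℝ] V →ₗ[ℝ] ℝ) (hB : ∀ x y, B x y = B y x)
    (h : ∀ W : Submodule ℝ V, (∀ ξ ∈ W, ξ ≠ 0 → 0 < B ξ ξ) → Module.finrank ℝ W ≤ 1)
    {x : V} (hx : 0 < B x x) (y : V) : B x x * B y y ≤ B x y ^ 2 := by
  by_contra! hlt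
  have key : ∀ a b : ℝ, B x x * B (a • x + b • y) (a • x + b • y) =
      (a * B x x + b * B x y) ^ 2 + b ^ 2 * (B x x * B y y - B x y ^ 2) := by
    intro a b
    simp only [map_add, map_smul, LinearMap.add_apply, LinearMap.smul_apply, smul_eq_mul, hB y x]
    ring
  have hzero : ∀ a b : ℝ, B (a • x + b • y) (a • x + b • y) ≤ 0 → a = 0 ∧ b = 0 := by
    intro a b hab
    have h1 : (a * B x x + b * B x y) ^ 2 + b ^ 2 * (B x x * B y y - B x y ^ 2) ≤ 0 :=
      key a b ▸ mul_nonpos_of_nonneg_of_nonpos hx.le hab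
    have hb : b = 0 := by
      by_contra hb
      have := mul_pos (pow_pos (abs_pos.2 hb) 2) (sub_pos.2 hlt)
      rw [sq_abs] at this
      nlinarith [sq_nonneg (a * B x x + b * B x y)]
    subst hb
    refine ⟨?_, rfl⟩
    have h2 : (a * B x x) ^ 2 ≤ 0 := by simpa using h1
    have h3 := pow_eq_zero_iff (two_ne_zero) |>.1 (le_antisymm h2 (sq_nonneg _))
    exact (mul_eq_zero.1 h3).resolve_right hx.ne'
  have hli : LinearIndependent ℝ ![x, y] := by
    rw [LinearIndependent.pair_iff]
    intro a b hab
    exact hzero a b (by simp [hab])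
  have hrank := finrank_span_eq_card hli
  have := h (Submodule.span ℝ (Set.range ![x, y])) (by
    intro ξ hξ hne
    rw [Matrix.range_cons, Matrix.range_cons, Matrix.range_empty, Set.union_empty,
      Set.singleton_union, Submodule.mem_span_pair] at hξ
    obtain ⟨a, b, rfl⟩ := hξ
    by_contra! hle
    obtain ⟨rfl, rfl⟩ := hzero a b hle
    simp at hne)
  rw [hrank] at this
  simp at this

/-- A reversed Cauchy-Schwarz form is nonpositive at a vector orthogonal to `u`, when
`u` pairs positively with some vector. -/
theorem nonpos_of_orthogonal {V : Type*} [AddCommGroup V] [Module ℝ V]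
    (B : V →ₗ[ℝ] V →ₗ[ℝ] ℝ) (hB : ∀ x y, B x y = B y x)
    (h : ∀ x, 0 < B x x → ∀ y, B x x * B y y ≤ B x y ^ 2) {u a : V}
    (hu : 0 ≤ B u u) (ha : 0 ≤ B a a) (hau : 0 < B a u) {x : V} (hx : B x u = 0) :
    B x x ≤ 0 := by
  by_contra! hpos
  have hp : 0 < B a u * B x x := mul_pos hau hpos
  set t : ℝ := (B x a ^ 2 + 1) / (B a u * B x x) with ht
  have ht' : t * (B a u * B x x) = B x a ^ 2 + 1 := div_mul_cancel₀ _ hp.ne'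
  have h1 := h x hpos (t • u + a)
  simp only [map_add, map_smul, LinearMap.add_apply, LinearMap.smul_apply, smul_eq_mul, hx,
    hB u a, mul_zero, zero_add] at h1
  have h2 : 0 ≤ B x x * (t * (t * B u u) + B a a) := by
    rw [← mul_assoc t t]
    exact mul_nonneg hpos.le (add_nonneg (mul_nonneg (mul_self_nonneg t) hu) ha)
  nlinarith [sq_nonneg (B x a)]

/-- Orthogonal projection onto a subspace of a space on which a symmetric form is
negative semidefinite. -/
theorem exists_sub_mem_orthogonal_s15 {V : Type*} [AddCommGroup V] [Module ℝ V]
    [FiniteDimensional ℝ V] (B : V →ₗ[ℝ] V →ₗ[ℝ] ℝ) (hB : ∀ x y, B x y = B y x)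
    {N K : Submodule ℝ V} (hN : ∀ x ∈ N, B x x ≤ 0) (hKN : K ≤ N) {α : V} (hα : α ∈ N) :
    ∃ β : V, β - α ∈ K ∧ ∀ z ∈ K, B z β = 0 := by
  let T : K →ₗ[ℝ] Module.Dual ℝ K := B.domRestrict₁₂ K K
  have hf : (B α).domRestrict K ∈ LinearMap.range T.dualMap := by
    rw [LinearMap.range_dualMap_eq_dualAnnihilator_ker, Submodule.mem_dualAnnihilator]
    intro z hz
    have hzz : B (z : V) z = 0 := LinearMap.congr_fun (LinearMap.mem_ker.1 hz) z
    change B α z = 0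
    by_contra hne
    have hquad : ∀ t : ℝ, 2 * t * B α z + B α α ≤ 0 := by
      intro t
      have := hN _ (N.add_mem (N.smul_mem t (hKN z.2)) hα)
      simp only [map_add, map_smul, LinearMap.add_apply, LinearMap.smul_apply, smul_eq_mul, hzz,
        hB (z : V) α] at this
      linarith
    have h1 := hquad ((1 - B α α) / (2 * B α z))
    have h2 : 2 * ((1 - B α α) / (2 * B α z)) * B α z = 1 - B α α := by field_simp
    linarith
  obtain ⟨φ, hφ⟩ := hf
  obtain ⟨k, rfl⟩ := (Module.evalEquiv ℝ K).surjective φ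
  refine ⟨α - k, by simp, fun z hz => ?_⟩
  have h2 : B z k = B α z := LinearMap.congr_fun hφ ⟨z, hz⟩
  rw [map_sub, h2, hB z α, sub_self]

/-- A bilinear form that is nonnegative on an open set and vanishes at a point of it is zero. -/
theorem eq_zero_of_nonneg_on_isOpen {V : Type*} [NormedAddCommGroup V] [NormedSpace ℝ V]
    (B : V →ₗ[ℝ] V →ₗ[ℝ] ℝ) {C : Set V} (hC : IsOpen C)
    (hnn : ∀ x ∈ C, ∀ y ∈ C, 0 ≤ B x y) {A : V} (hA : A ∈ C) (hAA : B A A = 0) (x y : V) :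
    B x y = 0 := by
  have hpert : ∀ x : V, ∃ t : ℝ, 0 < t ∧ A + t • x ∈ C ∧ A + t • (-x) ∈ C := by
    intro x
    have hev : ∀ x : V, ∀ᶠ t : ℝ in nhds 0, A + t • x ∈ C := fun x => by
      have hc : ContinuousAt (fun t : ℝ => A + t • x) 0 := by fun_prop
      exact hc.eventually_mem (by simpa using hC.mem_nhds hA)
    obtain ⟨t, ⟨h1, h2⟩, h3⟩ := (((hev x).and (hev (-x))).filter_mono nhdsWithin_le_nhds |>.and
      (self_mem_nhdsWithin : Set.Ioi (0 : ℝ) ∈ nhdsWithin 0 (Set.Ioi 0))).exists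
    exact ⟨t, h3, h1, h2⟩
  have hleft : ∀ x, B x A = 0 := by
    intro x
    obtain ⟨t, ht, h1, h2⟩ := hpert x
    have h3 := hnn _ h1 A hA
    have h4 := hnn _ h2 A hA
    simp only [map_add, map_smul, map_neg, LinearMap.add_apply, LinearMap.smul_apply,
      LinearMap.neg_apply, smul_eq_mul, hAA] at h3 h4
    nlinarith
  have hright : ∀ y, B A y = 0 := by
    intro y
    obtain ⟨t, ht, h1, h2⟩ := hpert y
    have h3 := hnn A hA _ h1
    have h4 := hnn A hA _ h2
    simp only [map_add, map_smul, map_neg, smul_eq_mul, hAA] at h3 h4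
    nlinarith
  obtain ⟨s, hs, h1, h2⟩ := hpert x
  obtain ⟨t, ht, h3, -⟩ := hpert y
  have h5 := hnn _ h1 _ h3
  have h6 := hnn _ h2 _ h3
  simp only [map_add, map_smul, map_neg, LinearMap.add_apply, LinearMap.smul_apply,
    LinearMap.neg_apply, smul_eq_mul, hAA, hleft, hright] at h5 h6
  have hst : 0 < t * s := mul_pos ht hs
  have : (t * s) * B x y = 0 := by linarith
  exact (mul_eq_zero.1 this).resolve_left hst.ne'

theorem biEval_eq_slotForm {V : Type*} [AddCommGroup V] [Module ℝ V] {n : ℕ}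
    (F : MultilinearMap ℝ (fun _ : Fin n => V) ℝ) (v : Fin n → V) {i j : Fin n}
    (hi : (i : ℕ) = 0) (hj : (j : ℕ) = 1) (hij : i ≠ j) (x y : V) :
    biEval F v x y = slotForm F v hij x y := by
  rw [slotForm_apply, biEval]
  congr 1
  funext k
  simp only [Function.update_apply, Fin.ext_iff, hi, hj]
  split_ifs <;> first | rfl | omega

/-- Multilinear forms on a finite-dimensional space are continuous. -/
theorem continuous_multilinearMap {V : Type*} [NormedAddCommGroup V] [NormedSpace ℝ V]
    [FiniteDimensional ℝ V] {n : ℕ} (F : MultilinearMap ℝ (fun _ : Fin n => V) ℝ) :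
    Continuous F := by
  let b := Module.finBasis ℝ V
  have hF : ∀ v, F v = ∑ f : Fin n → Fin (Module.finrank ℝ V),
      (∏ i, b.coord (f i) (v i)) • F fun i => b (f i) := by
    intro v
    conv_lhs => rw [show v = fun i => ∑ j, b.coord j (v i) • b j from
      funext fun i => (b.sum_repr (v i)).symm]
    rw [F.map_sum]
    exact Finset.sum_congr rfl fun f _ => F.map_smul_univ _ _
  rw [show (F : (Fin n → V) → ℝ) = _ from funext hF]
  have hb : ∀ j, Continuous (b.coord j) := fun j => (b.coord j).continuous_of_finiteDimensional
  exact continuous_finsetSum _ fun f _ => (continuous_finsetProd _ fun i _ =>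
    (hb (f i)).comp (continuous_apply i)).smul continuous_const

/-- The reversed Cauchy-Schwarz inequality of a Lorentzian form extends to the closed cone. -/
theorem slotForm_mul_le_sq_of_mem_closure {V : Type*} [NormedAddCommGroup V] [NormedSpace ℝ V]
    [FiniteDimensional ℝ V] {n : ℕ} {C : Set V}
    (F : MultilinearMap ℝ (fun _ : Fin n => V) ℝ)
    (hF : ∀ (σ : Equiv.Perm (Fin n)) (v : Fin n → V), F (v ∘ σ) = F v) {i j : Fin n}
    (hij : i ≠ j)
    (h : ∀ v : Fin n → V, (∀ k, v k ∈ C) → ∀ W : Submodule ℝ V,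
      (∀ ξ ∈ W, ξ ≠ 0 → 0 < slotForm F v hij ξ ξ) → Module.finrank ℝ W ≤ 1)
    {v : Fin n → V} (hv : ∀ k, v k ∈ closure C) {x : V} (hx : 0 < slotForm F v hij x x) (y : V) :
    slotForm F v hij x x * slotForm F v hij y y ≤ slotForm F v hij x y ^ 2 := by
  have hFc : Continuous F := continuous_multilinearMap F
  have hc : ∀ x y : V, Continuous fun v => slotForm F v hij x y := by
    intro x y
    simp only [slotForm_apply]
    exact hFc.comp ((continuous_id.update i continuous_const).update j continuous_const)
  have hclosed : IsClosed ({v | slotForm F v hij x x ≤ 0} ∪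
      {v | slotForm F v hij x x * slotForm F v hij y y ≤ slotForm F v hij x y ^ 2}) :=
    (isClosed_le (hc x x) continuous_const).union
      (isClosed_le ((hc x x).mul (hc y y)) ((hc x y).pow 2))
  have hsub : Set.univ.pi (fun _ : Fin n => C) ⊆ {v | slotForm F v hij x x ≤ 0} ∪
      {v | slotForm F v hij x x * slotForm F v hij y y ≤ slotForm F v hij x y ^ 2} := by
    intro u hu
    rcases le_or_gt (slotForm F u hij x x) 0 with hle | hlt
    · exact Or.inl hle
    · exact Or.inr (mul_le_sq_of_finrank_le_one _ (slotForm_comm F hF u hij)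
        (h u fun k => hu k trivial) hlt y)
  have hmem : v ∈ closure (Set.univ.pi fun _ : Fin n => C) := by
    rw [closure_pi_set]
    exact fun k _ => hv k
  exact (hclosed.closure_subset_iff.2 hsub hmem).resolve_left (not_le.2 hx)

/-- The arguments of `evalMinus` other than the first two, padded by `z`. -/
def minusTail {V : Type*} {n : ℕ} (hn : 3 ≤ n) (L : Fin (n - 2) → V) (r : Fin (n - 2)) (z : V) :
    Fin n → V := fun i =>
  if h₀ : (i : ℕ) ≤ 2 then z
  else if h : (i : ℕ) - 3 < (r : ℕ) then L ⟨(i : ℕ) - 3, by have := r.isLt; omega⟩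
  else L ⟨(i : ℕ) - 2, by have := i.isLt; omega⟩

theorem evalMinus_eq_slotForm {V : Type*} [AddCommGroup V] [Module ℝ V] {n : ℕ}
    (F : MultilinearMap ℝ (fun _ : Fin n => V) ℝ) (hn : 3 ≤ n) (L : Fin (n - 2) → V)
    (r : Fin (n - 2)) {i j : Fin n} (hi : (i : ℕ) = 0) (hj : (j : ℕ) = 1) (hij : i ≠ j)
    (x y z : V) :
    evalMinus F hn L r x y z = slotForm F (minusTail hn L r z) hij x y := by
  rw [slotForm_apply, evalMinus]
  congr 1
  funext k
  simp only [Function.update_apply, minusTail, Fin.ext_iff, hi, hj]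
  split_ifs <;> first | rfl | omega

/-- The arguments of `evalKer` other than the last two, padded by `0`. -/
def kerHead {V : Type*} [Zero V] {n : ℕ} (L : Fin (n - 2) → V) : Fin n → V := fun i =>
  if h : (i : ℕ) < n - 2 then L ⟨(i : ℕ), h⟩ else 0

theorem evalKer_eq_slotForm {V : Type*} [AddCommGroup V] [Module ℝ V] {n : ℕ}
    (F : MultilinearMap ℝ (fun _ : Fin n => V) ℝ) (L : Fin (n - 2) → V) {i j : Fin n}
    (hi : (i : ℕ) = n - 2) (hj : (j : ℕ) = n - 1) (hij : i ≠ j) (x y : V) :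
    evalKer F L x y = slotForm F (kerHead L) hij x y := by
  have hne : (i : ℕ) ≠ j := fun h => hij (Fin.ext h)
  rw [slotForm_apply, evalKer]
  congr 1
  funext k
  have := k.isLt
  simp only [Function.update_apply, kerHead, Fin.ext_iff, hi, hj]
  split_ifs <;> first | rfl | omega

/-- Reinserting the omitted member of the collection. -/
theorem evalMinus_self {V : Type*} [AddCommGroup V] [Module ℝ V] {n : ℕ}
    (F : MultilinearMap ℝ (fun _ : Fin n => V) ℝ)
    (hF : ∀ (σ : Equiv.Perm (Fin n)) (v : Fin n → V), F (v ∘ σ) = F v)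
    (hn : 3 ≤ n) (L : Fin (n - 2) → V) (r : Fin (n - 2)) (x z : V) :
    evalMinus F hn L r x (L r) z = evalKer F L x z := by
  let s : Fin n → Fin n := fun i =>
    if (i : ℕ) = 0 then ⟨n - 2, by omega⟩
    else if (i : ℕ) = 1 then ⟨r, by have := r.isLt; omega⟩
    else if (i : ℕ) = 2 then ⟨n - 1, by omega⟩
    else if (i : ℕ) - 3 < (r : ℕ) then ⟨(i : ℕ) - 3, by have := i.isLt; omega⟩
    else ⟨(i : ℕ) - 2, by have := i.isLt; omega⟩
  have hs : Function.Injective s := by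
    intro a b hab
    have ha := a.isLt
    have hb := b.isLt
    have hr := r.isLt
    simp only [s] at hab
    rw [Fin.ext_iff]
    split_ifs at hab <;> simp only [Fin.mk.injEq] at hab <;> omega
  rw [evalKer, ← hF (Equiv.ofBijective s (Finite.injective_iff_bijective.1 hs)), evalMinus]
  congr 1
  funext k
  have hk := k.isLt
  have hr := r.isLt
  simp only [Function.comp_apply, Equiv.ofBijective_apply, s]
  by_cases h0 : (k : ℕ) = 0
  · simp [h0]
  by_cases h1 : (k : ℕ) = 1
  · simp [h1]
  by_cases h2 : (k : ℕ) = 2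
  · have e1 : ¬ n - 1 < n - 2 := by omega
    have e2 : n - 1 ≠ n - 2 := by omega
    simp [h2, e1, e2]
  by_cases h3 : (k : ℕ) - 3 < r
  · have e1 : (k : ℕ) - 3 < n - 2 := by omega
    simp [h0, h1, h2, h3, e1]
  · have e1 : (k : ℕ) - 2 < n - 2 := by omega
    simp [h0, h1, h2, h3, e1]

/-- (Key Claim in the proof of the local Hodge index inequality.)
Setting as in the local Hodge index inequality: `F` a `C`-Lorentzian symmetric `n`-multilinear
form (`n ≥ 3`), `Eff` a closed convex cone containing the closure of `C` on which `F` is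
nonnegative against nef classes, `L₁, ..., L_{n-2}` a critical collection, and `𝒞 ⊆ Eff` a
generating set. Fix `r ∈ [n-2]` and `A ∈ C`. Then for every `α ∈ ker 𝔏` there is `β` with
`β - α ∈ span(𝒞 ∩ ker 𝔏)` and `F(D, β, A, 𝔏_{\ r}) = 0` for every `D ∈ 𝒞 ∩ ker 𝔏`. -/
theorem local_hodge_index_claim
    {V : Type*} [NormedAddCommGroup V] [NormedSpace ℝ V] [FiniteDimensional ℝ V]
    {n : ℕ} (hn : 3 ≤ n)
    (C : Set V) (hCne : C.Nonempty) (hCopen : IsOpen C) (hCconv : Convex ℝ C)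
    (hCcone : ∀ x ∈ C, ∀ t : ℝ, 0 < t → t • x ∈ C)
    (F : MultilinearMap ℝ (fun _ : Fin n => V) ℝ)
    (hFsymm : ∀ (σ : Equiv.Perm (Fin n)) (v : Fin n → V), F (v ∘ σ) = F v)
    (hFpos : ∀ v : Fin n → V, (∀ i, v i ∈ C) → 0 < F v)
    (hFlor : ∀ v : Fin n → V, (∀ i : Fin n, 2 ≤ (i : ℕ) → v i ∈ C) →
      (∃ ξ : V, 0 < biEval F v ξ ξ) ∧
      ∀ W : Submodule ℝ V, (∀ ξ ∈ W, ξ ≠ 0 → 0 < biEval F v ξ ξ) →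
        Module.finrank ℝ W ≤ 1)
    (Eff : Set V) (hEffClosed : IsClosed Eff) (hEffConv : Convex ℝ Eff)
    (hEffCone : ∀ x ∈ Eff, ∀ t : ℝ, 0 < t → t • x ∈ Eff)
    (hCEff : closure C ⊆ Eff)
    (hEffNonneg : ∀ v : Fin n → V, v ⟨0, by omega⟩ ∈ Eff →
      (∀ i : Fin n, (i : ℕ) ≠ 0 → v i ∈ closure C) → 0 ≤ F v)
    (L : Fin (n - 2) → V) (hL : ∀ i, L i ∈ closure C)
    (w : V) (hw : w ∈ C)
    (hcrit : ∀ I : Finset (Fin (n - 2)), I.Nonempty →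
      I.card + 1 ≤ numDim F w (∑ i ∈ I, L i))
    (𝒞 : Set V) (h𝒞Eff : 𝒞 ⊆ Eff)
    (hGen : closure {x : V | ∃ (s : Finset V) (c : V → ℝ),
      (∀ v ∈ s, 0 ≤ c v ∧ v ∈ 𝒞) ∧ x = ∑ v ∈ s, c v • v} = Eff)
    (hFin : (𝒞 ∩ {η : V | ∀ v : V, evalKer F L η v = 0}).Finite)
    (hHR : ∀ D ∈ 𝒞, ∀ v : Fin n → V, (∀ i : Fin n, 3 ≤ (i : ℕ) → v i ∈ closure C) →
      ∀ W : Submodule ℝ V, (∀ x ∈ W, x ≠ 0 → 0 < triEval F v D x x) →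
        Module.finrank ℝ W ≤ 1)
    (r : Fin (n - 2)) (A : V) (hA : A ∈ C)
    (α : V) (hα : ∀ v : V, evalKer F L α v = 0) :
    ∃ β : V,
      β - α ∈ Submodule.span ℝ (𝒞 ∩ {η : V | ∀ v : V, evalKer F L η v = 0}) ∧
      ∀ D ∈ 𝒞 ∩ {η : V | ∀ v : V, evalKer F L η v = 0},
        evalMinus F hn L r D β A = 0 := by
  have h01 : (⟨0, by omega⟩ : Fin n) ≠ ⟨1, by omega⟩ := by simp
  have hlast : (⟨n - 2, by omega⟩ : Fin n) ≠ ⟨n - 1, by omega⟩ := by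
    simp only [ne_eq, Fin.mk.injEq]; omega
  have hFnonneg : ∀ v : Fin n → V, (∀ i, v i ∈ closure C) → 0 ≤ F v := fun v hv =>
    hEffNonneg v (hCEff (hv _)) fun i _ => hv i
  have hker : ∀ x y, evalKer F L x y = slotForm F (kerHead L) hlast x y :=
    evalKer_eq_slotForm F L rfl rfl hlast
  have hminus : ∀ x y, evalMinus F hn L r x y A = slotForm F (minusTail hn L r A) h01 x y :=
    fun x y => evalMinus_eq_slotForm F hn L r rfl rfl h01 x y A
  have hkerNonneg : ∀ x ∈ C, ∀ y ∈ C, 0 ≤ evalKer F L x y := by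
    intro x hx y hy
    refine hFnonneg _ fun i => ?_
    split_ifs
    exacts [hL _, subset_closure hx, subset_closure hy]
  set K : Submodule ℝ V := Submodule.span ℝ (𝒞 ∩ {η : V | ∀ v : V, evalKer F L η v = 0}) with hK
  rcases (hkerNonneg A hA A hA).eq_or_lt with hzero | hpos
  · have hall : ∀ x y, evalKer F L x y = 0 := by
      intro x y
      rw [hker]
      exact eq_zero_of_nonneg_on_isOpen _ hCopen (fun x hx y hy => hker x y ▸ hkerNonneg x hx y hy)
        hA (by rw [← hker, ← hzero]) x y
    have hEffK : Eff ⊆ K := by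
      rw [← hGen]
      refine closure_minimal ?_ K.closed_of_finiteDimensional
      rintro x ⟨s, c, hs, rfl⟩
      exact K.sum_mem fun v hv =>
        K.smul_mem _ (Submodule.subset_span ⟨(hs v hv).2, fun y => hall v y⟩)
    have hKtop : K = ⊤ := by
      refine K.eq_top_of_nonempty_interior' ⟨A, ?_⟩
      exact interior_maximal ((subset_closure.trans hCEff).trans hEffK) hCopen hA
    refine ⟨0, by simp [hKtop], fun D _ => ?_⟩
    rw [hminus, map_zero]
  · have htail : ∀ k, minusTail hn L r A k ∈ closure C := by
      intro k
      rw [minusTail]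
      split_ifs
      exacts [subset_closure hA, hL _, hL _]
    have hdiag : ∀ x ∈ closure C, 0 ≤ slotForm F (minusTail hn L r A) h01 x x := by
      intro x hx
      rw [slotForm_apply]
      refine hFnonneg _ fun k => ?_
      simp only [Function.update_apply]
      split_ifs
      exacts [hx, hx, htail k]
    have hcomm := slotForm_comm F hFsymm (minusTail hn L r A) h01
    let N : Submodule ℝ V := LinearMap.ker (slotForm F (kerHead L) hlast)
    have hmemN : ∀ x, (∀ v, evalKer F L x v = 0) → x ∈ N := fun x hx =>
      LinearMap.mem_ker.2 (LinearMap.ext fun v => by rw [← hker, hx, LinearMap.zero_apply])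
    have hKN : K ≤ N := Submodule.span_le.2 fun x hx => hmemN x hx.2
    have hNneg : ∀ x ∈ N, slotForm F (minusTail hn L r A) h01 x x ≤ 0 := by
      intro x hx
      refine nonpos_of_orthogonal _ hcomm ?_ (hdiag _ (hL r)) (hdiag A (subset_closure hA)) ?_ ?_
      · intro x hx y
        refine slotForm_mul_le_sq_of_mem_closure F hFsymm h01 ?_ htail hx y
        intro v hv W hW
        refine (hFlor v fun i _ => hv i).2 W fun ξ hξ hne => ?_
        rw [biEval_eq_slotForm F v rfl rfl h01]
        exact hW ξ hξ hne
      · rw [← hminus, evalMinus_self F hFsymm]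
        exact hpos
      · rw [← hminus, evalMinus_self F hFsymm, hker, LinearMap.mem_ker.1 hx, LinearMap.zero_apply]
    obtain ⟨β, hβK, hβ⟩ := exists_sub_mem_orthogonal_s15 _ hcomm hNneg hKN (hmemN α hα)
    exact ⟨β, hβK, fun D hD => by rw [hminus]; exact hβ D (Submodule.subset_span hD)⟩
end

section
/- Let F be a C-Lorentzian symmetric n-multilinear form (n ≥ 2) on a finite-dimensional real vector space V, where C ⊆ V is a nonempty open convex cone with closure C̄. Then for any A, B ∈ C̄ the sequence a_k = F(A[k], B[n−k]) for k = 0, 1, ..., n is log-concave: a_k² ≥ a_{k−1}·a_{k+1} for every k ∈ {1, ..., n−1}. -/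
/-- `powEval F A B k = F(A[k], B[n-k])`: `F` evaluated with `k` arguments equal to `A` and
`n - k` arguments equal to `B`. -/
noncomputable def powEval {V : Type*} [AddCommGroup V] [Module ℝ V] {n : ℕ}
    (F : MultilinearMap ℝ (fun _ : Fin n => V) ℝ) (A B : V) (k : ℕ) : ℝ :=
  F (fun i => if (i : ℕ) < k then A else B)

section helpers

variable {V : Type*} [AddCommGroup V] [Module ℝ V] {n : ℕ}
  (F : MultilinearMap ℝ (fun _ : Fin n => V) ℝ) (v : Fin n → V)

theorem biEval_eq_update_left (hn : 2 ≤ n) (x y : V) :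
    biEval F v x y =
      F (Function.update (fun i => if (i : ℕ) = 1 then y else v i) ⟨0, by omega⟩ x) := by
  unfold biEval
  congr 1
  funext i
  by_cases h : (i : ℕ) = 0 <;> simp [Function.update_apply, Fin.ext_iff, h]

theorem biEval_add_left (hn : 2 ≤ n) (x x' y : V) :
    biEval F v (x + x') y = biEval F v x y + biEval F v x' y := by
  simp only [biEval_eq_update_left F v hn, F.map_update_add]

theorem biEval_smul_left (hn : 2 ≤ n) (c : ℝ) (x y : V) :
    biEval F v (c • x) y = c * biEval F v x y := by
  simp only [biEval_eq_update_left F v hn, F.map_update_smul, smul_eq_mul]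

variable {F}

theorem biEval_comm (hn : 2 ≤ n)
    (hF : ∀ (σ : Equiv.Perm (Fin n)) (v : Fin n → V), F (v ∘ σ) = F v) (x y : V) :
    biEval F v x y = biEval F v y x := by
  unfold biEval
  rw [← hF (Equiv.swap ⟨0, by omega⟩ ⟨1, by omega⟩)]
  congr 1
  funext i
  simp only [Function.comp_apply, Equiv.swap_apply_def, Fin.ext_iff]
  split_ifs <;> simp_all

/-- The binomial expansion of the quadratic form attached to `biEval`. -/
theorem biEval_combination_self (hn : 2 ≤ n)
    (hF : ∀ (σ : Equiv.Perm (Fin n)) (v : Fin n → V), F (v ∘ σ) = F v) (x y : V) (s t : ℝ) :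
    biEval F v (s • x + t • y) (s • x + t • y) =
      s ^ 2 * biEval F v x x + 2 * s * t * biEval F v x y + t ^ 2 * biEval F v y y := by
  rw [biEval_add_left F v hn, biEval_smul_left F v hn, biEval_smul_left F v hn,
    biEval_comm v hn hF x, biEval_comm v hn hF y, biEval_add_left F v hn,
    biEval_add_left F v hn, biEval_smul_left F v hn, biEval_smul_left F v hn,
    biEval_smul_left F v hn, biEval_smul_left F v hn, biEval_comm v hn hF y x]
  ring

/-- The reversed Cauchy–Schwarz inequality for a form with at most one positive eigenvalue. -/
theorem biEval_mul_self_le_sq (hn : 2 ≤ n)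
    (hF : ∀ (σ : Equiv.Perm (Fin n)) (v : Fin n → V), F (v ∘ σ) = F v)
    (hW : ∀ W : Submodule ℝ V, (∀ ξ ∈ W, ξ ≠ 0 → 0 < biEval F v ξ ξ) →
      Module.finrank ℝ W ≤ 1) (x y : V) (hx : 0 < biEval F v x x) :
    biEval F v x x * biEval F v y y ≤ biEval F v x y ^ 2 := by
  by_contra! h
  have pos : ∀ s t : ℝ, s ≠ 0 ∨ t ≠ 0 → 0 < biEval F v (s • x + t • y) (s • x + t • y) := by
    intro s t hst
    rw [biEval_combination_self v hn hF]
    refine pos_of_mul_pos_right (a := biEval F v x x) ?_ hx.le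
    have key : biEval F v x x * (s ^ 2 * biEval F v x x + 2 * s * t * biEval F v x y +
        t ^ 2 * biEval F v y y) = (s * biEval F v x x + t * biEval F v x y) ^ 2 +
        t ^ 2 * (biEval F v x x * biEval F v y y - biEval F v x y ^ 2) := by ring
    rw [key]
    by_cases ht : t = 0
    · have hs : s ≠ 0 := by simpa [ht] using hst
      subst ht
      have := mul_ne_zero hs hx.ne'
      simp only [zero_mul, add_zero]
      positivity
    · have := sub_pos.2 h
      positivity
  have zero : biEval F v 0 0 = 0 := by
    simpa using biEval_smul_left F v hn 0 0 0
  have indep : LinearIndependent ℝ ![x, y] := by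
    rw [LinearIndependent.pair_iff]
    intro s t hst
    by_contra hne
    have := pos s t (by tauto)
    rw [hst, zero] at this
    exact this.false
  have hfin := hW (Submodule.span ℝ (Set.range ![x, y])) (by
    intro ξ hξ hne
    rw [Matrix.range_cons, Matrix.range_cons, Matrix.range_empty, Set.union_empty,
      Set.singleton_union, Submodule.mem_span_pair] at hξ
    obtain ⟨s, t, rfl⟩ := hξ
    refine pos s t ?_
    by_contra! hc
    exact hne (by simp [hc.1, hc.2]))
  rw [finrank_span_eq_card indep] at hfin
  simp at hfin

variable (A B : V) {k : ℕ}

theorem powEval_succ_eq_biEval (hk : 1 ≤ k) :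
    powEval F A B (k + 1) = biEval F (fun i => if (i : ℕ) < k + 1 then A else B) A A := by
  unfold powEval biEval
  congr 1
  funext i
  grind

theorem powEval_eq_biEval (hn : 2 ≤ n)
    (hF : ∀ (σ : Equiv.Perm (Fin n)) (v : Fin n → V), F (v ∘ σ) = F v)
    (hk : 1 ≤ k) (hkn : k < n) :
    powEval F A B k = biEval F (fun i => if (i : ℕ) < k + 1 then A else B) A B := by
  unfold powEval biEval
  rw [← hF (Equiv.swap ⟨1, by omega⟩ ⟨k, hkn⟩)]
  congr 1
  funext i
  simp only [Function.comp_apply, Equiv.swap_apply_def, Fin.ext_iff]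
  grind

theorem powEval_pred_eq_biEval (hn : 2 ≤ n)
    (hF : ∀ (σ : Equiv.Perm (Fin n)) (v : Fin n → V), F (v ∘ σ) = F v)
    (hk : 1 ≤ k) (hkn : k < n) :
    powEval F A B (k - 1) = biEval F (fun i => if (i : ℕ) < k + 1 then A else B) B B := by
  unfold powEval biEval
  rw [← hF (Equiv.swap ⟨0, by omega⟩ ⟨k, hkn⟩ * Equiv.swap ⟨1, by omega⟩ ⟨k - 1, by omega⟩)]
  congr 1
  funext i
  simp only [Function.comp_apply, Equiv.Perm.mul_apply, Equiv.swap_apply_def, Fin.ext_iff]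
  grind

end helpers

theorem MultilinearMap.continuous_of_finiteDimensional {V ι : Type*} [Fintype ι]
    [NormedAddCommGroup V] [NormedSpace ℝ V] [FiniteDimensional ℝ V]
    (F : MultilinearMap ℝ (fun _ : ι => V) ℝ) : Continuous F := by
  classical
  let b := Module.finBasis ℝ V
  have hF : ⇑F = fun v : ι → V =>
      ∑ r : ι → Fin (Module.finrank ℝ V), (∏ i, b.coord (r i) (v i)) • F fun i => b (r i) := by
    funext v
    simp_rw [← F.map_smul_univ, Module.Basis.coord_apply]
    rw [← F.map_sum fun i j => b.repr (v i) j • b j]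
    simp_rw [b.sum_repr]
  rw [hF]
  refine continuous_finsetSum _ fun r _ => Continuous.mul ?_ continuous_const
  exact continuous_finsetProd _ fun i _ =>
    (b.coord (r i)).continuous_of_finiteDimensional.comp (continuous_apply i)

theorem continuous_powEval {V : Type*} [NormedAddCommGroup V] [NormedSpace ℝ V]
    [FiniteDimensional ℝ V] {n : ℕ} (F : MultilinearMap ℝ (fun _ : Fin n => V) ℝ) (k : ℕ) :
    Continuous fun p : V × V => powEval F p.1 p.2 k := by
  refine F.continuous_of_finiteDimensional.comp (continuous_pi fun i => ?_)
  split_ifs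
  exacts [continuous_fst, continuous_snd]

/-- Let `F` be a `C`-Lorentzian symmetric `n`-multilinear form (`n ≥ 2`) on
a finite-dimensional real vector space `V`, where `C ⊆ V` is a nonempty open convex cone.
Then for any `A, B` in the closure of `C`, the sequence `a_k = F(A[k], B[n-k])`,
`k = 0, 1, ..., n`, is log-concave: `a_k ^ 2 ≥ a_{k-1} * a_{k+1}` for `1 ≤ k ≤ n - 1`. -/
theorem lorentzian_log_concavity
    {V : Type*} [NormedAddCommGroup V] [NormedSpace ℝ V] [FiniteDimensional ℝ V]
    {n : ℕ} (hn : 2 ≤ n)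
    (C : Set V) (hCne : C.Nonempty) (hCopen : IsOpen C) (hCconv : Convex ℝ C)
    (hCcone : ∀ x ∈ C, ∀ t : ℝ, 0 < t → t • x ∈ C)
    (F : MultilinearMap ℝ (fun _ : Fin n => V) ℝ)
    (hFsymm : ∀ (σ : Equiv.Perm (Fin n)) (v : Fin n → V), F (v ∘ σ) = F v)
    (hFpos : ∀ v : Fin n → V, (∀ i, v i ∈ C) → 0 < F v)
    (hFlor : ∀ v : Fin n → V, (∀ i : Fin n, 2 ≤ (i : ℕ) → v i ∈ C) →
      (∃ ξ : V, 0 < biEval F v ξ ξ) ∧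
      ∀ W : Submodule ℝ V, (∀ ξ ∈ W, ξ ≠ 0 → 0 < biEval F v ξ ξ) →
        Module.finrank ℝ W ≤ 1)
    (A B : V) (hA : A ∈ closure C) (hB : B ∈ closure C)
    (k : ℕ) (hk1 : 1 ≤ k) (hk2 : k ≤ n - 1) :
    powEval F A B (k - 1) * powEval F A B (k + 1) ≤ powEval F A B k ^ 2 := by
  have hkn : k < n := by omega
  have on_cone : ∀ p ∈ C ×ˢ C,
      powEval F p.1 p.2 (k - 1) * powEval F p.1 p.2 (k + 1) ≤ powEval F p.1 p.2 k ^ 2 := by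
    rintro ⟨a, b⟩ ⟨ha, hb⟩
    dsimp only at ha hb ⊢
    have hpos : 0 < powEval F a b (k + 1) := hFpos _ fun i => by split_ifs <;> assumption
    rw [powEval_succ_eq_biEval a b hk1] at hpos ⊢
    rw [powEval_eq_biEval a b hn hFsymm hk1 hkn, powEval_pred_eq_biEval a b hn hFsymm hk1 hkn,
      mul_comm]
    exact biEval_mul_self_le_sq _ hn hFsymm
      (hFlor _ fun i _ => by split_ifs <;> assumption).2 a b hpos
  have hclosed : IsClosed {p : V × V |
      powEval F p.1 p.2 (k - 1) * powEval F p.1 p.2 (k + 1) ≤ powEval F p.1 p.2 k ^ 2} :=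
    isClosed_le ((continuous_powEval F _).mul (continuous_powEval F _))
      ((continuous_powEval F _).pow 2)
  have hmem : (A, B) ∈ closure (C ×ˢ C) := by
    rw [closure_prod_eq]
    exact ⟨hA, hB⟩
  exact closure_minimal on_cone hclosed hmem
end
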